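/- (Avron–van Mouche–Simon continuity) For every λ > 0 there exists δ > 0 such that for all α, α' ∈ ℝ with |α − α'| < δ, the Hausdorff distance between Σ^{λ,α} and Σ^{λ,α'} is at most 6 (2λ |α − α'|)^{1/2}, where Σ^{λ,β} = ⋃_{ω ∈ ℝ} σ(H^{λ,β}_ω). -/

import Mathlib

section SelfAdjoint

variable {E : Type*} [NormedAddCommGroup E] [InnerProductSpace ℂ E] [CompleteSpace E]

/-- A self-adjoint operator that is bounded below is invertible. -/
theorem IsSelfAdjoint.isUnit_of_forall_le_norm {T : E →L[ℂ] E} (hT : IsSelfAdjoint T) {c : ℝ}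
    (hc : 0 < c) (h : ∀ x, c * ‖x‖ ≤ ‖T x‖) : IsUnit T := by
  have hanti : AntilipschitzWith (Real.toNNReal c)⁻¹ T :=
    T.antilipschitz_of_bound fun x => by
      rw [NNReal.coe_inv, Real.coe_toNNReal c hc.le, inv_mul_eq_div, le_div_iff₀' hc]
      exact h x
  rw [ContinuousLinearMap.isUnit_iff_bijective,
    ContinuousLinearMap.bijective_iff_dense_range_and_antilipschitz]
  refine ⟨?_, _, hanti⟩
  rw [Submodule.topologicalClosure_eq_top_iff, ContinuousLinearMap.orthogonal_range,
    hT.adjoint_eq]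
  exact LinearMap.ker_eq_bot.mpr hanti.injective

theorem isSelfAdjoint_algebraMap_ofReal (e : ℝ) :
    IsSelfAdjoint (algebraMap ℂ (E →L[ℂ] E) e) :=
  IsSelfAdjoint.algebraMap (R := ℂ) (E →L[ℂ] E) (Complex.conj_ofReal e)

/-- A real point of the spectrum of a self-adjoint operator is an approximate eigenvalue. -/
theorem IsSelfAdjoint.exists_norm_sub_lt_of_mem_spectrum {T : E →L[ℂ] E} (hT : IsSelfAdjoint T)
    {e : ℝ} (he : (e : ℂ) ∈ spectrum ℂ T) {c : ℝ} (hc : 0 < c) :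
    ∃ x, ‖T x - (e : ℂ) • x‖ < c * ‖x‖ := by
  by_contra! h
  refine he (?_ : IsUnit _)
  rw [IsUnit.sub_iff]
  refine IsSelfAdjoint.isUnit_of_forall_le_norm (hT.sub (isSelfAdjoint_algebraMap_ofReal e)) hc
    fun x => ?_
  simpa [Algebra.algebraMap_eq_smul_one] using h x

/-- An approximate eigenvalue of a self-adjoint operator is close to the spectrum. -/
theorem IsSelfAdjoint.exists_mem_spectrum_of_norm_sub_le {T : E →L[ℂ] E} (hT : IsSelfAdjoint T)
    {e r : ℝ} (hr : 0 ≤ r) {x : E} (hx : x ≠ 0) (h : ‖T x - (e : ℂ) • x‖ ≤ r * ‖x‖) :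
    ∃ e' : ℝ, (e' : ℂ) ∈ spectrum ℂ T ∧ |e - e'| ≤ r := by
  by_cases he : (e : ℂ) ∈ spectrum ℂ T
  · exact ⟨e, he, by simpa using hr⟩
  have : Nontrivial E := ⟨x, 0, hx⟩
  have hS := hT.sub (isSelfAdjoint_algebraMap_ofReal (E := E) e)
  have hu : IsUnit (T - algebraMap ℂ (E →L[ℂ] E) e) := by
    rw [IsUnit.sub_iff]; exact not_not.mp he
  obtain ⟨u, hu⟩ := hu
  have hinv : IsSelfAdjoint (↑u⁻¹ : E →L[ℂ] E) := by
    have : IsSelfAdjoint u := by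
      ext1; rw [Units.coe_star, hu]; exact hS
    exact congrArg Units.val this.inv
  obtain ⟨k, hk, hk'⟩ := spectrum.exists_nnnorm_eq_spectralRadius (↑u⁻¹ : E →L[ℂ] E)
  rw [hinv.spectralRadius_eq_nnnorm, ENNReal.coe_inj] at hk'
  have hkn : ‖k‖ = ‖(↑u⁻¹ : E →L[ℂ] E)‖ := congrArg NNReal.toReal hk'
  have hk0 : k ≠ 0 := by
    rintro rfl
    exact spectrum.zero_notMem ℂ (Units.isUnit _) hk
  have hx1 : ‖x‖ ≤ ‖k‖ * (r * ‖x‖) := by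
    have h1 : (↑u⁻¹ : E →L[ℂ] E) ((u : E →L[ℂ] E) x) = x := by
      rw [← mul_apply_eq_comp, Units.inv_mul]; rfl
    have h2 : (u : E →L[ℂ] E) x = T x - (e : ℂ) • x := by
      rw [hu]; simp [Algebra.algebraMap_eq_smul_one]
    calc ‖x‖ = ‖(↑u⁻¹ : E →L[ℂ] E) ((u : E →L[ℂ] E) x)‖ := by rw [h1]
      _ ≤ ‖(↑u⁻¹ : E →L[ℂ] E)‖ * ‖(u : E →L[ℂ] E) x‖ := ContinuousLinearMap.le_opNorm _ _
      _ ≤ _ := by rw [h2, hkn]; gcongr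
  have hkr : ‖k⁻¹‖ ≤ r := by
    rw [norm_inv, inv_le_iff_one_le_mul₀ (norm_pos_iff.mpr hk0)]
    have := norm_pos_iff.mpr hx
    nlinarith
  have hmem : k⁻¹ ∈ spectrum ℂ (u : E →L[ℂ] E) := by
    have := (spectrum.inv_mem_iff (r := (Units.mk0 k hk0)) (a := u⁻¹)).mp (by simpa using hk)
    simpa using this
  have hmem' : k⁻¹ + e ∈ spectrum ℂ T := by
    rwa [spectrum.add_mem_iff, neg_add_eq_sub, ← hu]
  have hre := hT.mem_spectrum_eq_re hmem'
  refine ⟨(k⁻¹ + e).re, hre ▸ hmem', ?_⟩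
  rw [Complex.add_re, Complex.ofReal_re, sub_add_cancel_right, abs_neg]
  exact (Complex.abs_re_le_norm _).trans hkr

end SelfAdjoint

section Tent

/-- The tent function of half-width `L` on the integers. -/
noncomputable def tent (L : ℕ) (m : ℤ) : ℝ := max ((L : ℝ) - |(m : ℝ)|) 0

theorem tent_nonneg (L : ℕ) (m : ℤ) : 0 ≤ tent L m := le_max_right _ _

theorem tent_le (L : ℕ) (m : ℤ) : tent L m ≤ L :=
  max_le (sub_le_self _ (abs_nonneg _)) L.cast_nonneg

theorem tent_eq_zero {L : ℕ} {m : ℤ} (h : (L : ℤ) ≤ |m|) : tent L m = 0 :=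
  max_eq_right (sub_nonpos.mpr (by exact_mod_cast h))

theorem tent_eq_sub {L : ℕ} {m : ℤ} (h : |m| ≤ L) : tent L m = L - |(m : ℝ)| :=
  max_eq_left (sub_nonneg.mpr (by exact_mod_cast h))

theorem tent_natCast {L n : ℕ} (h : n ≤ L) : tent L n = L - n := by
  rw [tent_eq_sub (by rw [Nat.abs_cast]; exact_mod_cast h)]; simp

theorem tent_neg (L : ℕ) (m : ℤ) : tent L (-m) = tent L m := by simp [tent]

theorem tent_neg_succ {L n : ℕ} (h : n < L) : tent L (-((n : ℤ) + 1)) = L - (n + 1) := by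
  rw [tent_neg, ← Nat.cast_succ, tent_natCast h]; simp

theorem hasSum_int_of_forall_le_eq_zero {f : ℤ → ℝ} (L : ℕ) (h₁ : ∀ n : ℕ, L ≤ n → f n = 0)
    (h₂ : ∀ n : ℕ, L ≤ n → f (-(n + 1)) = 0) :
    HasSum f (∑ n ∈ Finset.range L, f n + ∑ n ∈ Finset.range L, f (-(n + 1))) :=
  HasSum.of_nat_of_neg_add_one
    (hasSum_sum_of_ne_finset_zero fun n hn => h₁ n (by simpa using hn))
    (hasSum_sum_of_ne_finset_zero fun n hn => h₂ n (by simpa using hn))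

theorem sum_range_sub_sq (x : ℝ) (k : ℕ) :
    ∑ n ∈ Finset.range k, (x - n) ^ 2 =
      k * x ^ 2 - x * (k * (k - 1)) + k * (k - 1) * (2 * k - 1) / 6 := by
  induction k with
  | zero => simp
  | succ k ih => rw [Finset.sum_range_succ, ih]; push_cast; ring

theorem sum_range_sq_mul_sub_sq (x : ℝ) (k : ℕ) :
    ∑ n ∈ Finset.range k, (n : ℝ) ^ 2 * (x - n) ^ 2 =
      x ^ 2 * (k * (k - 1) * (2 * k - 1) / 6) - 2 * x * (k * (k - 1) / 2) ^ 2 +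
        k * (k - 1) * (2 * k - 1) * (3 * k ^ 2 - 3 * k - 1) / 30 := by
  induction k with
  | zero => simp
  | succ k ih => rw [Finset.sum_range_succ, ih]; push_cast; ring

theorem hasSum_tent_sq (L : ℕ) :
    HasSum (fun m => tent L m ^ 2) ((L : ℝ) * (2 * L ^ 2 + 1) / 3) := by
  have h := hasSum_int_of_forall_le_eq_zero (f := fun m => tent L m ^ 2) L
    (fun n hn => by
      rw [tent_eq_zero (by rw [Nat.abs_cast]; exact_mod_cast hn)]; simp)
    (fun n hn => by
      rw [tent_eq_zero (by rw [abs_neg, ← Nat.cast_succ, Nat.abs_cast]; omega)]; simp)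
  convert! h using 1
  have h₁ : ∑ n ∈ Finset.range L, tent L (n : ℤ) ^ 2 =
      ∑ n ∈ Finset.range L, ((L : ℝ) - n) ^ 2 :=
    Finset.sum_congr rfl fun n hn => by rw [tent_natCast (Finset.mem_range.mp hn).le]
  have h₂ : ∑ n ∈ Finset.range L, tent L (-((n : ℤ) + 1)) ^ 2 =
      ∑ n ∈ Finset.range L, ((L - 1 : ℝ) - n) ^ 2 :=
    Finset.sum_congr rfl fun n hn => by rw [tent_neg_succ (Finset.mem_range.mp hn)]; ring
  rw [h₁, h₂, sum_range_sub_sq, sum_range_sub_sq]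
  ring

theorem hasSum_sq_mul_tent_sq (L : ℕ) :
    HasSum (fun m : ℤ => (m : ℝ) ^ 2 * tent L m ^ 2) ((L : ℝ) * (L ^ 4 - 1) / 15) := by
  have h := hasSum_int_of_forall_le_eq_zero (f := fun m : ℤ => (m : ℝ) ^ 2 * tent L m ^ 2) L
    (fun n hn => by
      rw [tent_eq_zero (by rw [Nat.abs_cast]; exact_mod_cast hn)]; simp)
    (fun n hn => by
      rw [tent_eq_zero (by rw [abs_neg, ← Nat.cast_succ, Nat.abs_cast]; omega)]; simp)
  convert! h using 1
  have h₁ : ∑ n ∈ Finset.range L, (((n : ℤ) : ℝ)) ^ 2 * tent L (n : ℤ) ^ 2 =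
      ∑ n ∈ Finset.range L, (n : ℝ) ^ 2 * ((L : ℝ) - n) ^ 2 :=
    Finset.sum_congr rfl fun n hn => by rw [tent_natCast (Finset.mem_range.mp hn).le]; simp
  have h₂ : ∑ n ∈ Finset.range L, ((-((n : ℤ) + 1) : ℤ) : ℝ) ^ 2 * tent L (-((n : ℤ) + 1)) ^ 2 =
      ∑ n ∈ Finset.range (L + 1), (n : ℝ) ^ 2 * ((L : ℝ) - n) ^ 2 := by
    rw [Finset.sum_range_succ']
    simp only [Nat.cast_zero, ne_eq, OfNat.ofNat_ne_zero, not_false_eq_true, zero_pow, zero_mul,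
      add_zero]
    exact Finset.sum_congr rfl fun n hn => by
      rw [tent_neg_succ (Finset.mem_range.mp hn)]; push_cast; ring
  rw [h₁, h₂, Finset.sum_range_succ, sum_range_sq_mul_sub_sq]
  ring

theorem hasSum_tent_succ_sub_sq (L : ℕ) :
    HasSum (fun m : ℤ => (tent L (m + 1) - tent L m) ^ 2) (2 * L : ℝ) := by
  have h := hasSum_int_of_forall_le_eq_zero
    (f := fun m : ℤ => (tent L (m + 1) - tent L m) ^ 2) L
    (fun n hn => by
      simp [tent_eq_zero (L := L) (m := n) (le_abs.mpr (by omega)),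
        tent_eq_zero (L := L) (m := n + 1) (le_abs.mpr (by omega))])
    (fun n hn => by
      rw [tent_eq_zero (L := L) (m := -(n + 1)) (le_abs.mpr (by omega)),
        tent_eq_zero (L := L) (m := -(n + 1) + 1) (le_abs.mpr (by omega))]; simp)
  convert! h using 1
  have h₁ : ∑ n ∈ Finset.range L, (tent L ((n : ℤ) + 1) - tent L n) ^ 2 =
      ∑ n ∈ Finset.range L, (1 : ℝ) :=
    Finset.sum_congr rfl fun n hn => by
      rw [← Nat.cast_succ, tent_natCast (Finset.mem_range.mp hn).le,
        tent_natCast (Finset.mem_range.mp hn)]; push_cast; ring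
  have h₂ : ∑ n ∈ Finset.range L,
      (tent L (-((n : ℤ) + 1) + 1) - tent L (-((n : ℤ) + 1))) ^ 2 =
      ∑ n ∈ Finset.range L, (1 : ℝ) :=
    Finset.sum_congr rfl fun n hn => by
      rw [tent_neg_succ (Finset.mem_range.mp hn), neg_add_rev, neg_add_cancel_comm, tent_neg,
        tent_natCast (Finset.mem_range.mp hn).le]; ring
  rw [h₁, h₂]
  simp; ring

theorem hasSum_tent_pred_sub_sq (L : ℕ) :
    HasSum (fun m : ℤ => (tent L (m - 1) - tent L m) ^ 2) (2 * L : ℝ) := by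
  refine ((Equiv.subRight (1 : ℤ)).hasSum_iff.mpr (hasSum_tent_succ_sub_sq L)).congr_fun
    fun m => ?_
  simp; ring

end Tent

section SquareSummable

local notation "ℓ²" => lp (fun _ : ℤ => ℂ) 2

theorem lp_two_hasSum_norm_sq (x : ℓ²) : HasSum (fun n => ‖x n‖ ^ 2) (‖x‖ ^ 2) := by
  simpa using lp.hasSum_norm (p := 2) (by simp) x

theorem lp_two_hasSum_inner (x y : ℓ²) :
    HasSum (fun n => inner ℂ (x n) (y n)) (inner ℂ x y) :=
  lp.hasSum_inner x y

theorem summable_inner_shift (x y : ℓ²) (k l : ℤ) :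
    Summable fun n => inner ℂ (x (n + k)) (y (n + l)) := by
  have hx := (Equiv.addRight k).summable_iff.mpr (lp_two_hasSum_norm_sq x).summable
  have hy := (Equiv.addRight l).summable_iff.mpr (lp_two_hasSum_norm_sq y).summable
  refine Summable.of_norm_bounded (hx.add hy) fun n => ?_
  refine (norm_inner_le_norm _ _).trans ?_
  simp only [Function.comp_apply, Equiv.coe_addRight]
  nlinarith [sq_nonneg (‖x (n + k)‖ - ‖y (n + l)‖), sq_nonneg (‖x (n + k)‖),
    sq_nonneg (‖y (n + l)‖)]

/-- A discrete Schrödinger operator with real potential is self-adjoint. -/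
theorem isSelfAdjoint_of_apply_eq_add_mul {H : ℓ² →L[ℂ] ℓ²} {V : ℤ → ℝ}
    (hH : ∀ ψ n, H ψ n = ψ (n + 1) + ψ (n - 1) + (V n : ℂ) * ψ n) : IsSelfAdjoint H := by
  refine ContinuousLinearMap.isSelfAdjoint_iff_isSymmetric.mpr fun x y => ?_
  have hu := ((summable_inner_shift x y 1 0).sub (summable_inner_shift x y 0 1)).hasSum
  have h₂ := hu.sub ((Equiv.subRight (1 : ℤ)).hasSum_iff.mpr hu)
  rw [sub_self] at h₂
  have h₁ := (lp_two_hasSum_inner (H x) y).sub (lp_two_hasSum_inner x (H y))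
  refine sub_eq_zero.mp (h₁.unique (h₂.congr_fun fun n => ?_))
  simp only [hH, RCLike.inner_apply, Function.comp_apply, Equiv.subRight_apply, sub_add_cancel,
    add_zero, map_add, map_mul, Complex.conj_ofReal]
  ring

/-- Pointwise multiplication of a square-summable sequence by a translated tent function. -/
noncomputable def tentCut (L : ℕ) (j : ℤ) (ψ : ℓ²) : ℓ² :=
  ⟨fun n => (tent L (n - j) : ℂ) * ψ n,
    ((lp.memℓp ψ).const_mul (L : ℂ)).mono' fun n => by
      rw [norm_mul, norm_mul, Complex.norm_of_nonneg (tent_nonneg _ _), Complex.norm_natCast]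
      gcongr
      exact tent_le _ _⟩

theorem tentCut_apply (L : ℕ) (j : ℤ) (ψ : ℓ²) (n : ℤ) :
    tentCut L j ψ n = (tent L (n - j) : ℂ) * ψ n := rfl

theorem hasSum_translate_mul_norm_sq {w : ℤ → ℝ} {S : ℝ} (hw : HasSum w S) (hw₀ : 0 ≤ w)
    (ψ : ℓ²) (k : ℤ) :
    HasSum (fun p : ℤ × ℤ => w (p.2 - p.1) * ‖ψ (p.2 + k)‖ ^ 2) (S * ‖ψ‖ ^ 2) := by
  have hψ := lp_two_hasSum_norm_sq ψ
  have h := hw.mul hψ (hw.summable.mul_of_nonneg hψ.summable hw₀ fun n => sq_nonneg _)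
  let e : ℤ × ℤ ≃ ℤ × ℤ :=
    { toFun := fun p => (p.2 - p.1, p.2 + k)
      invFun := fun q => (q.2 - k - q.1, q.2 - k)
      left_inv := fun p => by ext <;> simp
      right_inv := fun q => by ext <;> simp }
  exact e.hasSum_iff.mpr h

theorem add_sq_le_weighted {A B C D a b c : ℝ} (ha : 0 < a) (hb : 0 < b) (hc : 0 < c) :
    (A + B + C + D) ^ 2 ≤
      (a + b + c) * (A ^ 2 / a + 2 * (B ^ 2 + C ^ 2) / b + D ^ 2 / c) := by
  obtain ⟨p, rfl⟩ : ∃ p, A = a * p := ⟨A / a, by field_simp⟩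
  obtain ⟨q, hq⟩ : ∃ q, B + C = b * q := ⟨(B + C) / b, by field_simp⟩
  obtain ⟨r, rfl⟩ : ∃ r, D = c * r := ⟨D / c, by field_simp⟩
  have h₁ : (a * p) ^ 2 / a = a * p ^ 2 := by field_simp
  have h₂ : b * q ^ 2 ≤ 2 * (B ^ 2 + C ^ 2) / b := by
    rw [le_div_iff₀ hb]
    calc b * q ^ 2 * b = (B + C) ^ 2 := by rw [hq]; ring
      _ ≤ _ := by nlinarith [sq_nonneg (B - C)]
  have h₃ : (c * r) ^ 2 / c = c * r ^ 2 := by field_simp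
  rw [add_assoc (a * p), hq, h₁, h₃]
  calc (a * p + b * q + c * r) ^ 2
      ≤ (a + b + c) * (a * p ^ 2 + b * q ^ 2 + c * r ^ 2) := by
        nlinarith [mul_nonneg (mul_pos ha hb).le (sq_nonneg (p - q)),
          mul_nonneg (mul_pos ha hc).le (sq_nonneg (p - r)),
          mul_nonneg (mul_pos hb hc).le (sq_nonneg (q - r))]
    _ ≤ _ := by gcongr

/-- Localization with tent functions: let `H` and `H' j` be discrete Schrödinger operators whose
potentials differ at `n` by at most `K * |n - j|`. Then some localized piece of an approximate
eigenvector of `H` is an approximate eigenvector of some `H' j`. -/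
theorem exists_tentCut_norm_sub_lt {H : ℓ² →L[ℂ] ℓ²} {H' : ℤ → ℓ² →L[ℂ] ℓ²} {V : ℤ → ℝ}
    {V' : ℤ → ℤ → ℝ} {K : ℝ}
    (hH : ∀ ψ n, H ψ n = ψ (n + 1) + ψ (n - 1) + (V n : ℂ) * ψ n)
    (hH' : ∀ j ψ n, H' j ψ n = ψ (n + 1) + ψ (n - 1) + (V' j n : ℂ) * ψ n)
    (hV : ∀ j n, |V' j n - V n| ≤ K * |((n - j : ℤ) : ℝ)|)
    {L : ℕ} (hL : 0 < L) {a b c r e : ℝ} (ha : 0 < a) (hb : 0 < b) (hc : 0 < c)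
    (hbL : 12 ≤ b ^ 2 * L ^ 2) (hcK : K ^ 2 * L ^ 2 ≤ 10 * c ^ 2) (hr : a + b + c < r)
    {ψ : ℓ²} (hψ : ‖H ψ - (e : ℂ) • ψ‖ < a * ‖ψ‖) :
    ∃ j, ‖H' j (tentCut L j ψ) - (e : ℂ) • tentCut L j ψ‖ < r * ‖tentCut L j ψ‖ := by
  by_contra! hcon
  have hψ₀ : 0 < ‖ψ‖ := by
    by_contra! h
    have := norm_nonneg (H ψ - (e : ℂ) • ψ)
    nlinarith
  have hL' : (1 : ℝ) ≤ L := by exact_mod_cast hL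
  set φ : ℓ² := H ψ - (e : ℂ) • ψ with hφ
  set S : ℝ := (L : ℝ) * (2 * L ^ 2 + 1) / 3 with hS
  have hS₀ : 0 < S := by positivity
  have hlow : HasSum (fun j => r ^ 2 * ‖tentCut L j ψ‖ ^ 2) (r ^ 2 * (S * ‖ψ‖ ^ 2)) := by
    refine HasSum.mul_left _ ?_
    refine (hasSum_translate_mul_norm_sq (hasSum_tent_sq L) (fun m => sq_nonneg _) ψ 0
      ).prod_fiberwise fun j => ?_
    refine (lp_two_hasSum_norm_sq (tentCut L j ψ)).congr_fun fun n => ?_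
    rw [tentCut_apply, norm_mul, Complex.norm_of_nonneg (tent_nonneg _ _), mul_pow, add_zero]
  have hup := ((((hasSum_translate_mul_norm_sq (hasSum_tent_sq L) (fun m => sq_nonneg _) φ 0
    ).div_const a).add
    ((((hasSum_translate_mul_norm_sq (hasSum_tent_succ_sub_sq L) (fun m => sq_nonneg _) ψ 1).add
    (hasSum_translate_mul_norm_sq (hasSum_tent_pred_sub_sq L) (fun m => sq_nonneg _) ψ (-1))
    ).mul_left 2).div_const b)).add
    (((hasSum_translate_mul_norm_sq (hasSum_sq_mul_tent_sq L)
      (fun m => mul_nonneg (sq_nonneg _) (sq_nonneg _)) ψ 0).mul_left (K ^ 2)).div_const c)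
    ).mul_left (a + b + c)
  set F : ℤ × ℤ → ℝ := fun p =>
    ‖(H' p.1 (tentCut L p.1 ψ) - (e : ℂ) • tentCut L p.1 ψ : ℓ²) p.2‖ ^ 2 with hF
  have hFle : ∀ p, F p ≤ (a + b + c) * (tent L (p.2 - p.1) ^ 2 * ‖φ (p.2 + 0)‖ ^ 2 / a +
      2 * ((tent L (p.2 - p.1 + 1) - tent L (p.2 - p.1)) ^ 2 * ‖ψ (p.2 + 1)‖ ^ 2 +
        (tent L (p.2 - p.1 - 1) - tent L (p.2 - p.1)) ^ 2 * ‖ψ (p.2 + -1)‖ ^ 2) / b +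
      K ^ 2 * (((p.2 - p.1 : ℤ) : ℝ) ^ 2 * tent L (p.2 - p.1) ^ 2 * ‖ψ (p.2 + 0)‖ ^ 2) / c) := by
    intro p
    obtain ⟨j, n⟩ := p
    have hdec : (H' j (tentCut L j ψ) - (e : ℂ) • tentCut L j ψ : ℓ²) n =
        (tent L (n - j) : ℂ) * φ n +
        ((tent L (n - j + 1) - tent L (n - j) : ℝ) : ℂ) * ψ (n + 1) +
        ((tent L (n - j - 1) - tent L (n - j) : ℝ) : ℂ) * ψ (n - 1) +
        ((V' j n - V n : ℝ) : ℂ) * ((tent L (n - j) : ℂ) * ψ n) := by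
      simp only [hφ, lp.coeFn_sub, lp.coeFn_smul, Pi.sub_apply, Pi.smul_apply, hH, hH',
        tentCut_apply, smul_eq_mul, sub_add_eq_add_sub, sub_right_comm n j]
      push_cast
      ring
    have hD : (|V' j n - V n| * (tent L (n - j) * ‖ψ n‖)) ^ 2 ≤
        K ^ 2 * (((n - j : ℤ) : ℝ) ^ 2 * tent L (n - j) ^ 2 * ‖ψ n‖ ^ 2) := by
      have h := pow_le_pow_left₀ (abs_nonneg _) (hV j n) 2
      rw [mul_pow K, sq_abs ((n - j : ℤ) : ℝ)] at h
      calc _ = |V' j n - V n| ^ 2 * (tent L (n - j) ^ 2 * ‖ψ n‖ ^ 2) := by ring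
        _ ≤ K ^ 2 * ((n - j : ℤ) : ℝ) ^ 2 * (tent L (n - j) ^ 2 * ‖ψ n‖ ^ 2) := by gcongr
        _ = _ := by ring
    simp only [hF, add_zero, ← sub_eq_add_neg]
    rw [hdec]
    calc _ ≤ (tent L (n - j) * ‖φ n‖ + |tent L (n - j + 1) - tent L (n - j)| * ‖ψ (n + 1)‖ +
          |tent L (n - j - 1) - tent L (n - j)| * ‖ψ (n - 1)‖ +
          |V' j n - V n| * (tent L (n - j) * ‖ψ n‖)) ^ 2 := by
          gcongr
          refine (norm_add₄_le).trans_eq ?_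
          simp only [norm_mul, Complex.norm_real, Real.norm_eq_abs, abs_of_nonneg (tent_nonneg _ _)]
      _ ≤ _ := add_sq_le_weighted ha hb hc
      _ ≤ _ := by
          rw [mul_pow, mul_pow, mul_pow, sq_abs, sq_abs]
          gcongr
  have hFs : Summable F := hup.summable.of_nonneg_of_le (fun p => sq_nonneg _) hFle
  have hFj := hFs.hasSum.prod_fiberwise fun j => lp_two_hasSum_norm_sq
    (H' j (tentCut L j ψ) - (e : ℂ) • tentCut L j ψ)
  have hr₀ : 0 < r := by linarith
  have h₁ : r ^ 2 * (S * ‖ψ‖ ^ 2) ≤ ∑' p, F p := hasSum_le (fun j => by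
    rw [← mul_pow]
    exact pow_le_pow_left₀ (by positivity) (hcon j) 2) hlow hFj
  have h₂ := hasSum_le hFle hFs.hasSum hup
  have h₃ : S * ‖φ‖ ^ 2 / a ≤ a * (S * ‖ψ‖ ^ 2) := by
    rw [div_le_iff₀ ha]
    calc S * ‖φ‖ ^ 2 ≤ S * (a * ‖ψ‖) ^ 2 := by gcongr
      _ = _ := by ring
  have h₄ : 2 * (2 * L * ‖ψ‖ ^ 2 + 2 * L * ‖ψ‖ ^ 2) / b ≤ b * (S * ‖ψ‖ ^ 2) := by
    rw [div_le_iff₀ hb]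
    have : 8 * (L : ℝ) ≤ b ^ 2 * S := by
      calc 8 * (L : ℝ) ≤ (b ^ 2 * L ^ 2) * L * 2 / 3 := by nlinarith
        _ ≤ b ^ 2 * S := by rw [hS]; nlinarith [mul_nonneg (sq_nonneg b) L.cast_nonneg (α := ℝ)]
    nlinarith [mul_le_mul_of_nonneg_right this (sq_nonneg ‖ψ‖)]
  have h₅ : K ^ 2 * ((L : ℝ) * (L ^ 4 - 1) / 15 * ‖ψ‖ ^ 2) / c ≤ c * (S * ‖ψ‖ ^ 2) := by
    rw [div_le_iff₀ hc]
    have : K ^ 2 * ((L : ℝ) * (L ^ 4 - 1) / 15) ≤ c ^ 2 * S := by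
      calc K ^ 2 * ((L : ℝ) * (L ^ 4 - 1) / 15)
          ≤ K ^ 2 * ((L : ℝ) * L ^ 4 / 15) := by gcongr; linarith
        _ = (K ^ 2 * L ^ 2) * (L ^ 3 / 15) := by ring
        _ ≤ (10 * c ^ 2) * (L ^ 3 / 15) := by gcongr
        _ ≤ c ^ 2 * S := by rw [hS]; nlinarith [mul_nonneg (sq_nonneg c) L.cast_nonneg (α := ℝ)]
    nlinarith [mul_le_mul_of_nonneg_right this (sq_nonneg ‖ψ‖)]
  have h₆ : r ^ 2 * (S * ‖ψ‖ ^ 2) ≤ (a + b + c) ^ 2 * (S * ‖ψ‖ ^ 2) := by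
    refine h₁.trans (h₂.trans ?_)
    calc _ ≤ (a + b + c) * (a * (S * ‖ψ‖ ^ 2) + b * (S * ‖ψ‖ ^ 2) + c * (S * ‖ψ‖ ^ 2)) :=
          mul_le_mul_of_nonneg_left (add_le_add (add_le_add h₃ h₄) h₅) (by positivity)
      _ = _ := by ring
  have h₇ : (a + b + c) ^ 2 < r ^ 2 := pow_lt_pow_left₀ hr (by positivity) two_ne_zero
  exact absurd h₆ (not_le.mpr (mul_lt_mul_of_pos_right h₇ (by positivity)))

/-- One-sided form of the continuity of the spectrum of the almost Mathieu operator. -/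
theorem exists_mem_almostMathieu_spectrum_abs_sub_le {Hop : ℝ → ℝ → ℝ → (ℓ² →L[ℂ] ℓ²)}
    (hHop : ∀ (lam β ω : ℝ) (ψ : ℓ²) (n : ℤ),
      (Hop lam β ω ψ) n = ψ (n + 1) + ψ (n - 1) +
        (↑(2 * lam * Real.cos (2 * Real.pi * (ω + n * β))) : ℂ) * ψ n)
    {lam α α' ω e s : ℝ} (hlam : 0 < lam) (hs₀ : 0 < s) (hs₁ : s ≤ 1)
    (hs : s ^ 2 = 2 * lam * |α - α'|) (he : (e : ℂ) ∈ spectrum ℂ (Hop lam α ω)) :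
    ∃ e' : ℝ, (∃ ω', (e' : ℂ) ∈ spectrum ℂ (Hop lam α' ω')) ∧ |e - e'| ≤ 6 * s := by
  have hsa : ∀ β ω, IsSelfAdjoint (Hop lam β ω) := fun β ω =>
    isSelfAdjoint_of_apply_eq_add_mul (hHop lam β ω)
  obtain ⟨ψ, hψ⟩ := (hsa α ω).exists_norm_sub_lt_of_mem_spectrum he (c := s / 10) (by positivity)
  set L := ⌈s⁻¹⌉₊
  have hL₀ : 0 < L := Nat.ceil_pos.mpr (by positivity)
  have hL₁ : 1 ≤ s * L := by
    have := mul_le_mul_of_nonneg_left (Nat.le_ceil s⁻¹) hs₀.le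
    rwa [mul_inv_cancel₀ hs₀.ne'] at this
  have hL₂ : s * L ≤ 2 := by
    have := mul_le_mul_of_nonneg_left (Nat.ceil_lt_add_one (inv_pos.mpr hs₀).le).le hs₀.le
    rw [mul_add, mul_inv_cancel₀ hs₀.ne'] at this
    linarith
  have hLpos : (0 : ℝ) < L := by exact_mod_cast hL₀
  obtain ⟨j, hj⟩ := exists_tentCut_norm_sub_lt (hHop lam α ω)
    (fun j => hHop lam α' (ω + j * α - j * α')) (K := 2 * Real.pi * s ^ 2)
    (fun j n => by
      rw [← mul_sub, abs_mul, abs_of_pos (by positivity)]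
      refine (mul_le_mul_of_nonneg_left (Real.abs_cos_sub_cos_le _ _) (by positivity)).trans_eq ?_
      rw [show 2 * Real.pi * (ω + j * α - j * α' + n * α') - 2 * Real.pi * (ω + n * α) =
        -(2 * Real.pi * ((α - α') * ((n - j : ℤ) : ℝ))) by push_cast; ring, abs_neg,
        abs_mul (2 * Real.pi), abs_mul (α - α'), abs_of_pos Real.two_pi_pos, hs]
      ring)
    hL₀ (a := s / 10) (b := 3.5 / L) (c := 2 * s ^ 2 * L) (r := 6 * s) (by positivity)
    (by positivity) (by positivity)
    (by rw [div_pow, div_mul_cancel₀ _ (by positivity)]; norm_num)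
    (by
      have hpi : Real.pi ^ 2 ≤ 10 := by nlinarith [Real.pi_lt_d2, Real.pi_pos]
      calc (2 * Real.pi * s ^ 2) ^ 2 * (L : ℝ) ^ 2
          = Real.pi ^ 2 * (4 * s ^ 4 * L ^ 2) := by ring
        _ ≤ 10 * (4 * s ^ 4 * L ^ 2) := by gcongr
        _ = 10 * (2 * s ^ 2 * L) ^ 2 := by ring)
    (by
      refine lt_of_mul_lt_mul_right ?_ hLpos.le
      rw [add_mul, add_mul, div_mul_cancel₀ _ hLpos.ne']
      nlinarith [mul_nonneg (sub_nonneg.mpr hL₁) (sub_nonneg.mpr hL₂)])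
    hψ
  have hx : tentCut L j ψ ≠ 0 := by
    intro h
    simp [h] at hj
  obtain ⟨e', he', hd⟩ := (hsa α' (ω + j * α - j * α')).exists_mem_spectrum_of_norm_sub_le
    (by positivity) hx hj.le
  exact ⟨e', ⟨_, he'⟩, hd⟩

end SquareSummable

/-- Avron–van Mouche–Simon continuity of the spectrum: suppose `Hop lam β ω` is the almost
Mathieu operator on `ℓ²(ℤ, ℂ)` with coupling `lam`, frequency `β` (rational or irrational)
and phase `ω`, and let `Σ^{λ,β} = ⋃_ω σ(Hop lam β ω)`. Then for every `λ > 0` there is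
`δ > 0` such that `|α − α'| < δ` implies
`dist_H(Σ^{λ,α}, Σ^{λ,α'}) ≤ 6 (2λ|α − α'|)^{1/2}`. -/
theorem avron_vanMouche_simon_continuity
    (Hop : ℝ → ℝ → ℝ → (lp (fun _ : ℤ => ℂ) 2 →L[ℂ] lp (fun _ : ℤ => ℂ) 2))
    (hHop : ∀ (lam β ω : ℝ) (ψ : lp (fun _ : ℤ => ℂ) 2) (n : ℤ),
      (Hop lam β ω ψ) n = ψ (n + 1) + ψ (n - 1) +
        (↑(2 * lam * Real.cos (2 * Real.pi * (ω + n * β))) : ℂ) * ψ n) :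
    ∀ lam : ℝ, 0 < lam → ∃ δ > (0 : ℝ), ∀ α α' : ℝ, |α - α'| < δ →
      Metric.hausdorffDist
          {E : ℝ | ∃ ω : ℝ, (E : ℂ) ∈ spectrum ℂ (Hop lam α ω)}
          {E : ℝ | ∃ ω : ℝ, (E : ℂ) ∈ spectrum ℂ (Hop lam α' ω)} ≤
        6 * Real.sqrt (2 * lam * |α - α'|) := by
  intro lam hlam
  refine ⟨1 / (2 * lam), by positivity, fun α α' hα => ?_⟩
  rcases eq_or_ne α α' with rfl | hne
  · simp
  have hd : 0 < 2 * lam * |α - α'| := mul_pos (by positivity) (abs_pos.mpr (sub_ne_zero.mpr hne))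
  have hs₀ := Real.sqrt_pos.mpr hd
  have hs₁ : Real.sqrt (2 * lam * |α - α'|) ≤ 1 := Real.sqrt_le_one.mpr (by
    rw [lt_div_iff₀' (by positivity)] at hα
    exact hα.le)
  have hs := Real.sq_sqrt hd.le
  refine Metric.hausdorffDist_le_of_mem_dist (by positivity) ?_ ?_
  · rintro e ⟨ω, he⟩
    exact exists_mem_almostMathieu_spectrum_abs_sub_le hHop hlam hs₀ hs₁ hs he
  · rintro e ⟨ω, he⟩
    exact exists_mem_almostMathieu_spectrum_abs_sub_le hHop hlam hs₀ hs₁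
      (by rw [hs, abs_sub_comm]) he
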